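/- For all natural numbers a, c, the number of transpose-complement plane partitions in the a×a×c box equals the signed count of symmetric plane partitions: #{T ∈ PP(a,a,c) : κ(τ(T)) = T} = ∑_{T ∈ PP(a,a,c), τ(T) = T} (−1)^{|T|}, as an identity of integers. -/

import Mathlib

open Finset

/-- A plane partition in an `a × b × c` box: a lower set of `Fin a × Fin b × Fin c`
for the componentwise order. -/
def IsPP (a b c : ℕ) (T : Finset (Fin a × Fin b × Fin c)) : Prop :=
  ∀ p ∈ T, ∀ q : Fin a × Fin b × Fin c,
    q.1 ≤ p.1 → q.2.1 ≤ p.2.1 → q.2.2 ≤ p.2.2 → q ∈ T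

set_option synthInstance.maxSize 400 in
instance (a b c : ℕ) : DecidablePred (IsPP a b c) := fun _ => by
  unfold IsPP; infer_instance

/-- Complementation of plane partitions:
`κ(T) = {(i,j,k) : (a-1-i, b-1-j, c-1-k) ∉ T}`. -/
def ppKappa (a b c : ℕ) (T : Finset (Fin a × Fin b × Fin c)) :
    Finset (Fin a × Fin b × Fin c) :=
  Finset.univ.filter fun p => (p.1.rev, p.2.1.rev, p.2.2.rev) ∉ T

theorem ppKappa_isPP {a b c : ℕ} {T : Finset (Fin a × Fin b × Fin c)}
    (hT : IsPP a b c T) : IsPP a b c (ppKappa a b c T) := by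
  intro p hp q h1 h2 h3
  simp only [ppKappa, Finset.mem_filter, Finset.mem_univ, true_and] at hp ⊢
  intro hq
  exact hp (hT _ hq _ (Fin.rev_le_rev.mpr h1) (Fin.rev_le_rev.mpr h2)
    (Fin.rev_le_rev.mpr h3))

/-- Transposition of plane partitions in an `a × a × c` box:
`τ(T) = {(j,i,k) : (i,j,k) ∈ T}`. -/
def ppTau (a c : ℕ) (T : Finset (Fin a × Fin a × Fin c)) :
    Finset (Fin a × Fin a × Fin c) :=
  T.image fun p => (p.2.1, p.1, p.2.2)

/-- The number of `r`-step walks on `ℤ` with steps `±1` and total displacement `x`. -/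
def walkNum : ℕ → ℤ → ℤ
  | 0, x => if x = 0 then 1 else 0
  | r + 1, x => walkNum r (x - 1) + walkNum r (x + 1)

theorem walkNum_neg (r : ℕ) : ∀ x, walkNum r (-x) = walkNum r x := by
  induction r with
  | zero => intro x; simp [walkNum]
  | succ r ih =>
    intro x
    rw [walkNum, walkNum, ← ih (x - 1), ← ih (x + 1), add_comm]
    congr 2 <;> ring

theorem walkNum_of_lt_abs (r : ℕ) : ∀ x : ℤ, (r : ℤ) < |x| → walkNum r x = 0 := by
  induction r with
  | zero => intro x hx; simp only [walkNum]; rw [if_neg]; rintro rfl; simp at hx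
  | succ r ih =>
    intro x hx
    push_cast at hx
    rw [lt_abs] at hx
    rw [walkNum, ih, ih, add_zero] <;> rw [lt_abs] <;> omega

theorem walkNum_of_parity (r : ℕ) : ∀ x : ℤ, (x - r) % 2 ≠ 0 → walkNum r x = 0 := by
  induction r with
  | zero => intro x hx; simp only [walkNum]; rw [if_neg]; rintro rfl; simp at hx
  | succ r ih =>
    intro x hx
    push_cast at hx
    rw [walkNum, ih, ih, add_zero] <;> omega

theorem sum_walkNum_mul (S : Finset ℤ) (r : ℕ) (f : ℤ → ℤ) (n : ℕ) (y : ℤ)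
    (hf : ∀ z, f z = walkNum n (z - y)) (hS : ∀ z, z ∉ S → f z = 0) :
    ∀ u, ∑ z ∈ S, walkNum r (u - z) * f z = walkNum (r + n) (u - y) := by
  induction r with
  | zero =>
    intro u
    simp only [walkNum, sub_eq_zero, ite_mul, one_mul, zero_mul, sum_ite_eq, zero_add]
    split_ifs with h
    · exact hf u
    · rw [← hf u, hS u h]
  | succ r ih =>
    intro u
    have h1 := ih (u - 1)
    have h2 := ih (u + 1)
    simp only [walkNum, add_mul, sum_add_distrib]
    rw [Nat.add_right_comm, walkNum, show u - y - 1 = u - 1 - y by ring,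
      show u - y + 1 = u + 1 - y by ring, ← h1, ← h2]
    congr 1 <;> refine sum_congr rfl fun z _ => ?_
    · rw [show u - z - 1 = u - 1 - z by ring]
    · rw [show u - z + 1 = u + 1 - z by ring]

/-- The step `+1` or `-1` encoded by a Boolean. -/
def boolStep (b : Bool) : ℤ := if b then 1 else -1

/-- The displacement of `k` simultaneous walkers after the first `t` of `r` steps. -/
def walkPos {r k : ℕ} (E : Fin r → Fin k → Bool) (t : ℕ) (j : Fin k) : ℤ :=
  ∑ s ∈ range t, if h : s < r then boolStep (E ⟨s, h⟩ j) else 0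

@[simp] theorem walkPos_zero {r k : ℕ} (E : Fin r → Fin k → Bool) : walkPos E 0 = 0 := by
  ext j; simp [walkPos]

theorem walkPos_succ {r k : ℕ} (E : Fin r → Fin k → Bool) {t : ℕ} (h : t < r) (j : Fin k) :
    walkPos E (t + 1) j = walkPos E t j + boolStep (E ⟨t, h⟩ j) := by
  simp [walkPos, sum_range_succ, h]

theorem walkPos_snoc_of_le {r k : ℕ} (E : Fin r → Fin k → Bool) (e : Fin k → Bool) {t : ℕ}
    (ht : t ≤ r) : walkPos (Fin.snoc (α := fun _ => Fin k → Bool) E e) t = walkPos E t := by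
  ext j
  refine sum_congr rfl fun s hs => ?_
  have hs : s < r := by simp at hs; omega
  rw [dif_pos hs, dif_pos (by omega)]
  have : (⟨s, by omega⟩ : Fin (r + 1)) = Fin.castSucc ⟨s, hs⟩ := rfl
  rw [this, Fin.snoc_castSucc]

theorem walkPos_snoc_last {r k : ℕ} (E : Fin r → Fin k → Bool) (e : Fin k → Bool) (j : Fin k) :
    walkPos (Fin.snoc (α := fun _ => Fin k → Bool) E e) (r + 1) j =
      walkPos E r j + boolStep (e j) := by
  rw [walkPos_succ _ (Nat.lt_succ_self r), walkPos_snoc_of_le _ _ le_rfl]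
  have : (⟨r, Nat.lt_succ_self r⟩ : Fin (r + 1)) = Fin.last r := rfl
  rw [this, Fin.snoc_last]

open Classical in
/-- The step sequences of `k` walkers started at `ρ` that stay in the region `C` throughout. -/
noncomputable def walksIn {k : ℕ} (C : (Fin k → ℤ) → Prop) (ρ : Fin k → ℤ) (r : ℕ) :
    Finset (Fin r → Fin k → Bool) :=
  univ.filter fun E => ∀ t ≤ r, C (ρ + walkPos E t)

theorem mem_walksIn {k : ℕ} {C : (Fin k → ℤ) → Prop} {ρ : Fin k → ℤ} {r : ℕ}
    {E : Fin r → Fin k → Bool} : E ∈ walksIn C ρ r ↔ ∀ t ≤ r, C (ρ + walkPos E t) := by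
  simp [walksIn]

theorem snoc_mem_walksIn {k : ℕ} {C : (Fin k → ℤ) → Prop} {ρ : Fin k → ℤ} {r : ℕ}
    {E : Fin r → Fin k → Bool} {e : Fin k → Bool} :
    Fin.snoc (α := fun _ => Fin k → Bool) E e ∈ walksIn C ρ (r + 1) ↔
      E ∈ walksIn C ρ r ∧ C (ρ + walkPos E r + fun j => boolStep (e j)) := by
  have hl : ρ + walkPos (Fin.snoc (α := fun _ => Fin k → Bool) E e) (r + 1) =
      ρ + walkPos E r + fun j => boolStep (e j) := by
    ext j; simp [walkPos_snoc_last, add_assoc]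
  rw [mem_walksIn, mem_walksIn]
  constructor
  · intro h
    refine ⟨fun t ht => ?_, hl ▸ h _ le_rfl⟩
    rw [← walkPos_snoc_of_le E e ht]
    exact h t (by omega)
  · rintro ⟨h1, h2⟩ t ht
    rcases Nat.lt_or_ge r t with h | h
    · obtain rfl : t = r + 1 := by omega
      rwa [hl]
    · rw [walkPos_snoc_of_le E e h]
      exact h1 t h

theorem sum_snoc {r : ℕ} {X : Type*} [Fintype X] (f : (Fin (r + 1) → X) → ℤ) :
    ∑ E, f E = ∑ E : Fin r → X, ∑ e : X, f (Fin.snoc (α := fun _ => X) E e) := by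
  rw [← (Fin.snocEquiv fun _ : Fin (r + 1) => X).sum_comp, Fintype.sum_prod_type_right]
  rfl

open Classical in
theorem sum_walksIn_succ {k : ℕ} (C : (Fin k → ℤ) → Prop) (ρ : Fin k → ℤ) (r : ℕ)
    (f : (Fin (r + 1) → Fin k → Bool) → ℤ) :
    ∑ E ∈ walksIn C ρ (r + 1), f E = ∑ E ∈ walksIn C ρ r,
      ∑ e ∈ univ.filter (fun e => C (ρ + walkPos E r + fun j => boolStep (e j))),
        f (Fin.snoc (α := fun _ => Fin k → Bool) E e) := by
  have h (r : ℕ) (g : (Fin r → Fin k → Bool) → ℤ) :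
      ∑ E ∈ walksIn C ρ r, g E = ∑ E, if E ∈ walksIn C ρ r then g E else 0 := by
    rw [← sum_filter]; simp
  rw [h, h, sum_snoc]
  refine sum_congr rfl fun E _ => ?_
  simp only [snoc_mem_walksIn, sum_filter]
  split_ifs with hE <;> simp [hE]

open Classical in
/-- The number of `r`-step walks of `k` walkers from `ρ` to `w` inside the region `C`. -/
noncomputable def walkCount {k : ℕ} (C : (Fin k → ℤ) → Prop) (ρ : Fin k → ℤ) (r : ℕ)
    (w : Fin k → ℤ) : ℤ :=
  ∑ E ∈ walksIn C ρ r, if ρ + walkPos E r = w then 1 else 0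

theorem walkCount_eq_zero {k : ℕ} {C : (Fin k → ℤ) → Prop} {ρ : Fin k → ℤ} {r : ℕ}
    {w : Fin k → ℤ} (hw : ¬ C w) : walkCount C ρ r w = 0 := by
  refine sum_eq_zero fun E hE => if_neg ?_
  rintro rfl
  exact hw (mem_walksIn.1 hE r le_rfl)

theorem walkCount_succ {k : ℕ} {C : (Fin k → ℤ) → Prop} {ρ : Fin k → ℤ} {r : ℕ}
    {w : Fin k → ℤ} (hw : C w) :
    walkCount C ρ (r + 1) w =
      ∑ e : Fin k → Bool, walkCount C ρ r (w - fun j => boolStep (e j)) := by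
  classical
  simp only [walkCount]
  rw [sum_walksIn_succ, sum_comm]
  refine sum_congr rfl fun E _ => ?_
  rw [sum_filter]
  refine sum_congr rfl fun e _ => ?_
  have hl : ρ + walkPos (Fin.snoc (α := fun _ => Fin k → Bool) E e) (r + 1) =
      ρ + walkPos E r + fun j => boolStep (e j) := by
    ext j; simp [walkPos_snoc_last, add_assoc]
  rw [hl]
  by_cases h : ρ + walkPos E r + (fun j => boolStep (e j)) = w
  · rw [if_pos (h ▸ hw), if_pos h, if_pos (eq_sub_of_add_eq h)]
  · have h2 : ¬ (ρ + walkPos E r = w - fun j => boolStep (e j)) :=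
      fun h' => h (by rw [h', sub_add_cancel])
    rw [if_neg h, if_neg h2, ite_self]

/-- A determinant whose entries satisfy the walk recursion counts walks inside `C` as soon as it
does so initially and vanishes just outside `C`. -/
theorem walkCount_eq_det {k : ℕ} {C : (Fin k → ℤ) → Prop} {ρ : Fin k → ℤ}
    (h : ℕ → Fin k → ℤ → ℤ)
    (hrec : ∀ r i x, h (r + 1) i x = h r i (x - 1) + h r i (x + 1))
    (h0 : ∀ w, C w → walkCount C ρ 0 w = (Matrix.of fun i j => h 0 i (w j)).det)
    (hout : ∀ r w, C w → ∀ e : Fin k → Bool, ¬ C (w - fun j => boolStep (e j)) →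
      (Matrix.of fun i j => h r i (w j - boolStep (e j))).det = 0) (r : ℕ) :
    ∀ w, C w → walkCount C ρ r w = (Matrix.of fun i j => h r i (w j)).det := by
  induction r with
  | zero => exact h0
  | succ r ih =>
    intro w hw
    have hdet : (Matrix.of fun i j => h (r + 1) i (w j)).det =
        ∑ e : Fin k → Bool, (Matrix.of fun i j => h r i (w j - boolStep (e j))).det := by
      simp only [Matrix.det_apply', Matrix.of_apply]
      rw [sum_comm]
      refine sum_congr rfl fun σ _ => ?_
      rw [← mul_sum]
      congr 1
      rw [← Fintype.piFinset_univ,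
        ← prod_univ_sum (fun _ => univ) fun j b => h r (σ j) (w j - boolStep b)]
      refine prod_congr rfl fun j _ => ?_
      simp [hrec, boolStep]
    rw [walkCount_succ hw, hdet]
    refine sum_congr rfl fun e _ => ?_
    by_cases he : C (w - fun j => boolStep (e j))
    · rw [ih _ he]; rfl
    · rw [walkCount_eq_zero he, hout r w hw e he]

theorem det_indicator {k : ℕ} {ρ w : Fin k → ℤ} (hρ : StrictAnti ρ) (hw : StrictAnti w) :
    (Matrix.of fun i j => if w j = ρ i then (1 : ℤ) else 0).det = if ρ = w then 1 else 0 := by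
  split_ifs with h
  · subst h
    refine Eq.trans (congrArg Matrix.det ?_) (Matrix.det_one (n := Fin k))
    ext i j
    simp only [Matrix.of_apply, Matrix.one_apply, hρ.injective.eq_iff, eq_comm]
  · obtain ⟨j, hj⟩ : ∃ j, ∀ i, w j ≠ ρ i := by
      by_contra! hc
      choose f hf using hc
      have hf' : StrictMono f := fun a b hab => by
        have := hw hab
        rw [hf a, hf b] at this
        exact hρ.lt_iff_gt.1 this
      have : f = id := by
        apply (StrictMono.range_inj hf' strictMono_id).1
        rw [Set.range_id, (Finite.injective_iff_surjective.1 hf'.injective).range_eq]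
      exact h (by ext j; rw [hf j, this]; rfl)
    exact Matrix.det_eq_zero_of_column_eq_zero j fun i => by simp [hj i]

theorem walkCount_zero {k : ℕ} {C : (Fin k → ℤ) → Prop} {ρ : Fin k → ℤ} (hρ : C ρ)
    (w : Fin k → ℤ) : walkCount C ρ 0 w = if ρ = w then 1 else 0 := by
  classical
  have : walksIn C ρ 0 = univ := by
    ext E
    refine iff_of_true (mem_walksIn.2 fun t ht => ?_) (mem_univ _)
    obtain rfl := Nat.le_zero.1 ht
    simpa using hρ
  rw [walkCount, this]
  simp

/-- The region of strictly decreasing integer vectors whose entries all have the same parity. -/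
def SpacedAnti {k : ℕ} (w : Fin k → ℤ) : Prop := StrictAnti w ∧ ∀ i j, (2 : ℤ) ∣ w i - w j

theorem strictAnti_fin_succ_iff {k : ℕ} {f : Fin (k + 1) → ℤ} :
    StrictAnti f ↔ (∀ i : Fin k, f i.succ < f 0) ∧ StrictAnti fun i : Fin k => f i.succ := by
  refine ⟨fun h => ⟨fun i => h (Fin.succ_pos i), fun i j hij => h (Fin.succ_lt_succ_iff.2 hij)⟩,
    fun ⟨h1, h2⟩ i j hij => ?_⟩
  induction j using Fin.cases with
  | zero => exact absurd hij (Fin.not_lt_zero i)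
  | succ j =>
    induction i using Fin.cases with
    | zero => exact h1 j
    | succ i => exact h2 (Fin.succ_lt_succ_iff.1 hij)

theorem SpacedAnti.tail {k : ℕ} {w : Fin (k + 1) → ℤ} (h : SpacedAnti w) :
    SpacedAnti fun i : Fin k => w i.succ :=
  ⟨(strictAnti_fin_succ_iff.1 h.1).2, fun _ _ => h.2 _ _⟩

theorem SpacedAnti.gap {k : ℕ} {w : Fin k → ℤ} (h : SpacedAnti w) {i j : Fin k} (hij : i < j) :
    w j + 2 ≤ w i := by
  have h1 := h.1 hij
  have h2 := h.2 i j
  omega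

theorem boolStep_cases (b : Bool) : boolStep b = 1 ∨ boolStep b = -1 := by
  cases b <;> simp [boolStep]

/-- The entries of `w` are grouped into consecutive pairs with difference two. -/
def IsPaired {k : ℕ} (w : Fin k → ℤ) : Prop :=
  ∀ i, ∀ h : 2 * i < k, ∃ h' : 2 * i + 1 < k, w ⟨2 * i, h⟩ = w ⟨2 * i + 1, h'⟩ + 2

theorem isPaired_succ_succ {k : ℕ} {w : Fin (k + 2) → ℤ} :
    IsPaired w ↔ w 0 = w 1 + 2 ∧ IsPaired fun i : Fin k => w i.succ.succ := by
  refine ⟨fun h => ⟨(h 0 (by omega)).2, fun i hi => ⟨?_, ?_⟩⟩, fun ⟨h1, h2⟩ i hi => ?_⟩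
  · have := (h (i + 1) (by omega)).1; omega
  · exact (h (i + 1) (by omega)).2
  · cases i with
    | zero => exact ⟨by omega, h1⟩
    | succ i =>
      obtain ⟨h', h3⟩ := h2 i (by omega)
      exact ⟨by omega, h3⟩

theorem sum_bool_cons {k : ℕ} (f : (Fin (k + 1) → Bool) → ℤ) :
    ∑ e, f e = (∑ e : Fin k → Bool, f (Fin.cons (α := fun _ => Bool) true e)) +
      ∑ e : Fin k → Bool, f (Fin.cons (α := fun _ => Bool) false e) := by
  rw [← (Fin.consEquiv fun _ : Fin (k + 1) => Bool).sum_comp, Fintype.sum_prod_type,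
    Fintype.sum_bool]
  rfl

open Classical in
/-- The signed number of ways in which walkers at `w` can make one more step. -/
theorem sum_sign_step {k : ℕ} : ∀ w : Fin k → ℤ, SpacedAnti w →
    (∑ e : Fin k → Bool, if StrictAnti (fun j => w j + boolStep (e j)) then
      ∏ j, -boolStep (e j) else 0) = if IsPaired w then 1 else 0 := by
  induction k using Nat.twoStepInduction with
  | zero =>
    intro w _
    have h2 : IsPaired w := fun i hi => by omega
    rw [if_pos h2, Fintype.sum_unique, if_pos (Subsingleton.strictAnti _)]
    simp
  | one =>
    intro w _
    have h2 : ¬ IsPaired w := fun h => by have := (h 0 (by omega)).1; omega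
    simp only [Subsingleton.strictAnti, if_true, if_neg h2]
    rw [sum_bool_cons]
    simp [boolStep]
  | more k ih _ =>
    intro w hw
    have hw1 := hw.tail
    have hw2 := hw1.tail
    have h01 : w 1 + 2 ≤ w 0 := hw.gap (Fin.zero_lt_one)
    have hi1 (i : Fin k) : w i.succ.succ + 2 ≤ w 1 := hw1.gap (i := 0) (Fin.succ_pos i)
    have hs (i : Fin (k + 1)) : w i.succ ≤ w 1 := by
      induction i using Fin.cases with
      | zero => exact le_rfl
      | succ i => linarith [hi1 i]
    have hcons {k : ℕ} (w : Fin (k + 1) → ℤ) (b : Bool) (e : Fin k → Bool) :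
        StrictAnti (fun j => w j + boolStep (Fin.cons (α := fun _ => Bool) b e j)) ↔
        (∀ i, w i.succ + boolStep (e i) < w 0 + boolStep b) ∧
          StrictAnti fun j => w j.succ + boolStep (e j) := by
      rw [strictAnti_fin_succ_iff]
      simp only [Fin.cons_succ, Fin.cons_zero]
    rw [sum_bool_cons]
    simp only [hcons w, Fin.prod_univ_succ (n := k + 1), Fin.cons_succ, Fin.cons_zero]
    by_cases hg : w 0 = w 1 + 2
    · have ht (b : Bool) (e : Fin k → Bool) (i : Fin (k + 1)) :
          w i.succ + boolStep (Fin.cons (α := fun _ => Bool) b e i) < w 0 + boolStep true := by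
        have h1 := hs i
        simp only [boolStep]
        split_ifs <;> omega
      have hf (e : Fin k → Bool) (i : Fin (k + 1)) :
          w i.succ + boolStep (Fin.cons (α := fun _ => Bool) false e i) < w 0 + boolStep false := by
        induction i using Fin.cases with
        | zero => simp only [Fin.cons_zero, Fin.succ_zero_eq_one]; omega
        | succ i =>
          have h1 := hi1 i
          simp only [Fin.cons_succ, boolStep, Bool.false_eq_true, if_false]
          split_ifs <;> omega
      have hft (e : Fin k → Bool) : ¬ ∀ i : Fin (k + 1),
          w i.succ + boolStep (Fin.cons (α := fun _ => Bool) true e i) <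
            w 0 + boolStep false := fun h => by
        have := h 0
        simp [boolStep] at this
        omega
      have htail (e : Fin k → Bool) (i : Fin k) :
          w i.succ.succ + boolStep (e i) < w 1 + boolStep true := by
        have h1 := hi1 i
        simp only [boolStep, if_true]
        split_ifs <;> omega
      rw [sum_bool_cons, sum_bool_cons]
      simp only [ht, hf, hft, implies_true, true_and, false_and, if_false, sum_const_zero,
        zero_add, Fin.prod_univ_succ (n := k), Fin.cons_succ, Fin.cons_zero,
        hcons fun i : Fin (k + 1) => w i.succ, Fin.succ_zero_eq_one, htail]
      rw [isPaired_succ_succ, and_iff_right hg, ← ih _ hw2, add_assoc, ← sum_add_distrib]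
      refine Eq.trans (congrArg₂ _ (sum_congr rfl fun e _ => ?_)
        (sum_eq_zero fun e _ => ?_)) (add_zero _)
      · split_ifs <;> simp [boolStep]
      · split_ifs <;> simp [boolStep]
    · have h2 := hw.2 0 1
      have hall (b : Bool) (e : Fin (k + 1) → Bool) (i : Fin (k + 1)) :
          w i.succ + boolStep (e i) < w 0 + boolStep b := by
        have h1 := hs i
        rcases boolStep_cases (e i) with h | h <;> rcases boolStep_cases b with h' | h' <;>
          rw [h, h'] <;> omega
      rw [isPaired_succ_succ, if_neg fun h => hg h.1, ← sum_add_distrib]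
      refine sum_eq_zero fun e _ => ?_
      simp only [hall, implies_true, true_and]
      split_ifs <;> simp [boolStep]

theorem walkPos_eq_card {r k : ℕ} (E : Fin r → Fin k → Bool) (j : Fin k) :
    walkPos E r j = 2 * #{s | E s j = true} - r := by
  have h (b : Bool) : boolStep b = 2 * (if b = true then 1 else 0) - 1 := by
    cases b <;> simp [boolStep]
  rw [walkPos, sum_range]
  simp only [Fin.is_lt, dif_pos, Fin.eta, h, sum_sub_distrib, ← mul_sum, sum_boole]
  simp

theorem abs_walkPos_le {r k : ℕ} (E : Fin r → Fin k → Bool) (j : Fin k) :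
    |walkPos E r j| ≤ r := by
  have h : #{s | E s j = true} ≤ r := (card_le_univ _).trans (by simp)
  rw [walkPos_eq_card, abs_le]
  omega

theorem prod_neg_boolStep {r : ℕ} (e : Fin r → Bool) :
    ∏ s, -boolStep (e s) = (-1) ^ #{s | e s = true} := by
  rw [← prod_const, prod_filter]
  refine prod_congr rfl fun s _ => ?_
  cases e s <;> simp [boolStep]

theorem prod_eq_one_of_paired {k : ℕ} : ∀ f : Fin k → ℤ, (∀ i, ∀ h : 2 * i < k,
    ∃ h' : 2 * i + 1 < k, f ⟨2 * i, h⟩ * f ⟨2 * i + 1, h'⟩ = 1) → ∏ j, f j = 1 := by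
  induction k using Nat.twoStepInduction with
  | zero => intro f _; simp
  | one => intro f h; have := (h 0 (by omega)).1; omega
  | more k ih _ =>
    intro f h
    have h0 : f 0 * f 1 = 1 := (h 0 (by omega)).2
    rw [Fin.prod_univ_succ, Fin.prod_univ_succ, ← mul_assoc, Fin.succ_zero_eq_one, h0, one_mul]
    refine ih _ fun i hi => ?_
    obtain ⟨h1, h2⟩ := h (i + 1) (by omega)
    exact ⟨by omega, h2⟩

open Classical in
/-- Summing out the last step, only the walks ending in a paired position contribute. -/
theorem sum_sign_walksIn {k n : ℕ} {ρ : Fin k → ℤ}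
    (hρ : ∀ i, ∀ h : 2 * i + 1 < k, ρ ⟨2 * i, by omega⟩ = ρ ⟨2 * i + 1, h⟩ + 2) :
    ∑ E ∈ walksIn SpacedAnti ρ (n + 1), ∏ j, ∏ s, -boolStep (E s j) =
      ∑ E ∈ walksIn SpacedAnti ρ n, if IsPaired (ρ + walkPos E n) then 1 else 0 := by
  rw [sum_walksIn_succ]
  refine sum_congr rfl fun E hE => ?_
  have hw := mem_walksIn.1 hE n le_rfl
  have hspaced (e : Fin k → Bool) : SpacedAnti (ρ + walkPos E n + fun j => boolStep (e j)) ↔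
      StrictAnti fun j => (ρ + walkPos E n) j + boolStep (e j) := by
    refine ⟨fun h => h.1, fun h => ⟨h, fun i j => ?_⟩⟩
    have := hw.2 i j
    rw [Pi.add_apply (ρ + walkPos E n), Pi.add_apply (ρ + walkPos E n)]
    rcases boolStep_cases (e i) with h | h <;> rcases boolStep_cases (e j) with h' | h' <;>
      rw [h, h'] <;> omega
  have hsplit (e : Fin k → Bool) :
      ∏ j, ∏ s, -boolStep (Fin.snoc (α := fun _ => Fin k → Bool) E e s j) =
        (∏ j, ∏ s, -boolStep (E s j)) * ∏ j, -boolStep (e j) := by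
    rw [← prod_mul_distrib]
    refine prod_congr rfl fun j _ => ?_
    rw [Fin.prod_univ_castSucc]
    simp only [Fin.snoc_castSucc, Fin.snoc_last]
  simp only [hsplit, ← mul_sum, sum_filter, hspaced]
  have h := sum_sign_step _ hw
  rw [h]
  split_ifs with hp
  · rw [mul_one]
    refine prod_eq_one_of_paired _ fun i hi => ?_
    obtain ⟨h1, h2⟩ := hp i hi
    refine ⟨h1, ?_⟩
    have h3 := hρ i h1
    simp only [Pi.add_apply, walkPos_eq_card] at h2
    have h4 : #{s | E s ⟨2 * i, hi⟩ = true} = #{s | E s ⟨2 * i + 1, h1⟩ = true} := by omega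
    rw [prod_neg_boolStep, prod_neg_boolStep, h4, ← mul_pow]
    simp
  · rw [mul_zero]

open Equiv in
theorem sum_sign_mul_eq_zero {κ : Type*} [Fintype κ] [DecidableEq κ] {a b : κ} (hab : a ≠ b)
    (f : Perm κ → ℤ) (hf : ∀ σ, f (σ * swap a b) = f σ) :
    ∑ σ : Perm κ, (Perm.sign σ : ℤ) * f σ = 0 := by
  have h : ∑ σ : Perm κ, (Perm.sign σ : ℤ) * f σ = -∑ σ : Perm κ, (Perm.sign σ : ℤ) * f σ := by
    conv_lhs => rw [← Equiv.sum_comp (Equiv.mulRight (swap a b))]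
    rw [← sum_neg_distrib]
    refine sum_congr rfl fun σ _ => ?_
    simp [hf, Perm.sign_swap hab]
  omega

open Equiv in
/-- The signed sum over perfect matchings depends only on the antisymmetric part of the weights. -/
theorem sum_sign_prod_congr {ι : Type*} [Fintype ι] [DecidableEq ι] (M N : ι ⊕ ι → ι ⊕ ι → ℤ)
    (h : ∀ p q, M p q - N p q = M q p - N q p) :
    ∑ σ : Perm (ι ⊕ ι), (Perm.sign σ : ℤ) * ∏ i, M (σ (.inl i)) (σ (.inr i)) =
      ∑ σ : Perm (ι ⊕ ι), (Perm.sign σ : ℤ) * ∏ i, N (σ (.inl i)) (σ (.inr i)) := by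
  suffices hs : ∀ s : Finset ι,
      ∑ σ : Perm (ι ⊕ ι), (Perm.sign σ : ℤ) * ∏ i, M (σ (.inl i)) (σ (.inr i)) =
      ∑ σ : Perm (ι ⊕ ι), (Perm.sign σ : ℤ) *
        ∏ i, if i ∈ s then N (σ (.inl i)) (σ (.inr i)) else
        M (σ (.inl i)) (σ (.inr i)) by simpa using hs univ
  intro s
  induction s using Finset.induction_on with
  | empty => simp
  | insert a s ha ih =>
    rw [ih, ← sub_eq_zero, ← sum_sub_distrib]
    simp only [← mul_sub]
    refine sum_sign_mul_eq_zero (a := .inl a) (b := .inr a) (by simp) _ fun σ => ?_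
    have key (τ : Perm (ι ⊕ ι)) :
        (∏ i, if i ∈ s then N (τ (.inl i)) (τ (.inr i)) else M (τ (.inl i)) (τ (.inr i))) -
        (∏ i, if i ∈ insert a s then N (τ (.inl i)) (τ (.inr i)) else
          M (τ (.inl i)) (τ (.inr i))) =
        (M (τ (.inl a)) (τ (.inr a)) - N (τ (.inl a)) (τ (.inr a))) *
        ∏ i ∈ univ.erase a, if i ∈ s then N (τ (.inl i)) (τ (.inr i)) else
          M (τ (.inl i)) (τ (.inr i)) := by
      rw [← mul_prod_erase univ _ (mem_univ a), ← mul_prod_erase univ _ (mem_univ a),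
        if_neg ha, if_pos (mem_insert_self a s), sub_mul]
      congr 2
      refine prod_congr rfl fun i hi => ?_
      simp [ne_of_mem_erase hi]
    rw [key, key]
    congr 1
    · simp [h (σ (.inl a))]
    · refine prod_congr rfl fun i hi => ?_
      have hi := ne_of_mem_erase hi
      have h1 : swap (Sum.inl a) (Sum.inr a) (.inl i) = .inl i :=
        swap_apply_of_ne_of_ne (by simpa using hi) (by simp)
      have h2 : swap (Sum.inl a) (Sum.inr a) (.inr i) = .inr i :=
        swap_apply_of_ne_of_ne (by simp) (by simpa using hi)
      simp only [Perm.mul_apply, h1, h2]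

open Equiv in
/-- The signed matching sum of weights for which the left summand is isotropic. -/
theorem sum_sign_prod_isotropic {ι : Type*} [Fintype ι] [DecidableEq ι]
    (M : ι ⊕ ι → ι ⊕ ι → ℤ) (hM : ∀ i j, M (.inl i) (.inl j) = M (.inl j) (.inl i)) :
    ∑ σ : Perm (ι ⊕ ι), (Perm.sign σ : ℤ) * ∏ i, M (σ (.inl i)) (σ (.inr i)) =
      (Fintype.card ι).factorial *
        (Matrix.of fun i j => M (.inl i) (.inr j) - M (.inr j) (.inl i)).det := by
  classical
  set X : Matrix ι ι ℤ := Matrix.of fun i j => M (.inl i) (.inr j) - M (.inr j) (.inl i) with hX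
  let N : ι ⊕ ι → ι ⊕ ι → ℤ := fun p q => match p, q with
    | .inl _, .inl _ => 0
    | .inr _, .inl _ => 0
    | .inl i, .inr j => X i j
    | .inr i, .inr j => M (.inr i) (.inr j)
  rw [sum_sign_prod_congr M N]
  swap
  · rintro (i | i) (j | j)
    · simp [N, hM i j]
    · simp [N, hX]
    · simp [N, hX]
    · simp [N]
  have hr : ∑ σ : Perm (ι ⊕ ι), (Perm.sign σ : ℤ) * ∏ i, N (σ (.inl i)) (σ (.inr i)) =
      ∑ p : Perm ι × Perm ι, (Perm.sign p.1 : ℤ) * Perm.sign p.2 * ∏ i, X (p.1 i) (p.2 i) := by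
    refine (sum_of_injOn (fun p => p.1.sumCongr p.2) ?_ ?_ ?_ ?_).symm
    · intro p _ q _ h
      exact Perm.sumCongrHom_injective h
    · simp
    · intro σ _ hσ
      have h1 : ¬ ∀ x, ∃ y, Sum.inr y = σ (Sum.inr x) := fun h => hσ <| by
        have hl : Set.MapsTo σ (Set.range Sum.inl) (Set.range Sum.inl) := by
          choose f hf using h
          have hfi : Function.Injective f := fun x y hxy => by
            have := hf x
            rw [hxy, hf y] at this
            exact (Sum.inr_injective (σ.injective this)).symm
          rintro _ ⟨x, rfl⟩
          rcases hx : σ (.inl x) with y | y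
          · exact ⟨y, rfl⟩
          · obtain ⟨z, rfl⟩ := Finite.surjective_of_injective hfi y
            rw [hf z] at hx
            exact absurd (σ.injective hx) (by simp)
        obtain ⟨p, hp⟩ := Perm.mem_sumCongrHom_range_of_perm_mapsTo_inl hl
        exact ⟨p, by simp, hp⟩
      obtain ⟨a, ha⟩ := not_forall.1 h1
      rw [prod_eq_zero (mem_univ a), mul_zero]
      rcases hx : σ (.inr a) with y | y
      · rcases σ (.inl a) with z | z <;> rfl
      · exact absurd ⟨y, hx.symm⟩ ha
    · intro p _
      simp [N, Perm.sign_sumCongr]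
  rw [hr, Fintype.sum_prod_type_right]
  have hd (υ : Perm ι) : ∑ τ : Perm ι, (Perm.sign τ : ℤ) * Perm.sign υ * ∏ i, X (τ i) (υ i) =
      X.det := by
    have := Matrix.det_permute' υ X
    rw [Matrix.det_apply'] at this
    simp only [mul_right_comm _ (Perm.sign υ : ℤ)]
    rw [← sum_mul]
    simp only [Matrix.submatrix_apply, id, Int.cast_id] at this
    rw [this, mul_right_comm, ← Units.val_mul, Int.units_mul_self]
    simp
  simp [hd, Fintype.card_perm]

open Classical in
theorem sum_piFinset_eq_factorial_mul {m : ℕ} (S : Finset ℤ) (G : (Fin m → ℤ) → ℤ)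
    (hG : ∀ s (σ : Equiv.Perm (Fin m)), G (s ∘ σ) = G s)
    (hG0 : ∀ s, ¬ Function.Injective s → G s = 0) :
    ∑ s ∈ Fintype.piFinset fun _ => S, G s =
      m.factorial * ∑ s ∈ Fintype.piFinset fun _ => S, if StrictAnti s then G s else 0 := by
  have h1 (s : Fin m → ℤ) :
      G s = ∑ σ : Equiv.Perm (Fin m), if StrictAnti (s ∘ σ) then G (s ∘ σ) else 0 := by
    by_cases hs : Function.Injective s
    · set σ₀ : Equiv.Perm (Fin m) := Fin.revPerm.trans (Tuple.sort s) with hσ₀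
      have h0 : StrictAnti (s ∘ σ₀) := by
        have : StrictMono (s ∘ Tuple.sort s) :=
          (Tuple.monotone_sort s).strictMono_of_injective (hs.comp (Tuple.sort s).injective)
        exact this.comp_strictAnti Fin.rev_strictAnti
      rw [sum_eq_single_of_mem σ₀ (mem_univ _), if_pos h0, hG]
      intro σ _ hσ
      refine if_neg fun h => hσ ?_
      have := Tuple.unique_antitone h.antitone h0.antitone
      ext i
      exact congrArg Fin.val (hs (congrFun this i))
    · rw [hG0 s hs, sum_eq_zero]
      intro σ _
      rw [hG, hG0 s hs, ite_self]
  rw [sum_congr rfl fun s _ => h1 s, sum_comm]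
  have h2 (σ : Equiv.Perm (Fin m)) : (∑ s ∈ Fintype.piFinset fun _ => S,
      if StrictAnti (s ∘ σ) then G (s ∘ σ) else 0) =
      ∑ s ∈ Fintype.piFinset fun _ => S, if StrictAnti s then G s else 0 := by
    refine sum_equiv (Equiv.arrowCongr σ.symm (Equiv.refl ℤ)) (fun s => ?_) fun s _ => rfl
    simp only [Fintype.mem_piFinset]
    exact (σ.forall_congr_right (q := fun i => s i ∈ S)).symm
  simp [h2, Fintype.card_perm]

theorem SpacedAnti.det_sub_eq_zero {k : ℕ} {w : Fin k → ℤ} (hw : SpacedAnti w)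
    (h : Fin k → ℤ → ℤ) (e : Fin k → Bool)
    (he : ¬ StrictAnti (w - fun j => boolStep (e j))) :
    (Matrix.of fun i j => h i (w j - boolStep (e j))).det = 0 := by
  simp only [StrictAnti, not_forall, not_lt] at he
  obtain ⟨i, j, hij, h1⟩ := he
  refine Matrix.det_zero_of_column_eq hij.ne fun l => ?_
  have h2 := hw.gap hij
  have h3 : w i - boolStep (e i) = w j - boolStep (e j) := by
    simp only [Pi.sub_apply] at h1
    rcases boolStep_cases (e i) with h | h <;> rcases boolStep_cases (e j) with h' | h' <;>
      rw [h, h'] at h1 ⊢ <;> omega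
  simp [h3]

theorem SpacedAnti.sub_dvd {k : ℕ} {w : Fin k → ℤ} (hw : SpacedAnti w) (e : Fin k → Bool)
    (i j : Fin k) : (2 : ℤ) ∣ (w - fun j => boolStep (e j)) i - (w - fun j => boolStep (e j)) j := by
  have := hw.2 i j
  simp only [Pi.sub_apply]
  rcases boolStep_cases (e i) with h | h <;> rcases boolStep_cases (e j) with h' | h' <;>
    rw [h, h'] <;> omega

theorem walkCount_spacedAnti {k : ℕ} {ρ : Fin k → ℤ} (hρ : SpacedAnti ρ) (r : ℕ) (w : Fin k → ℤ)
    (hw : SpacedAnti w) :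
    walkCount SpacedAnti ρ r w = (Matrix.of fun i j => walkNum r (w j - ρ i)).det := by
  refine walkCount_eq_det (fun r i x => walkNum r (x - ρ i)) (fun r i x => ?_) (fun w hw => ?_)
    (fun r w hw e he => ?_) r w hw
  · rw [walkNum]; congr 2 <;> ring
  · rw [walkCount_zero hρ, ← det_indicator hρ.1 hw.1]
    simp only [walkNum, sub_eq_zero]
  · exact hw.det_sub_eq_zero (fun i x => walkNum r (x - ρ i)) e fun h => he ⟨h, hw.sub_dvd e⟩

/-- The region of positive vectors in `SpacedAnti`. -/
def SpacedPos {k : ℕ} (w : Fin k → ℤ) : Prop := SpacedAnti w ∧ ∀ j, 0 < w j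

theorem walkCount_spacedPos {k : ℕ} {ρ : Fin k → ℤ} (hρ : SpacedPos ρ) (r : ℕ) (w : Fin k → ℤ)
    (hw : SpacedPos w) : walkCount SpacedPos ρ r w =
      (Matrix.of fun i j => walkNum r (w j - ρ i) - walkNum r (w j + ρ i)).det := by
  refine walkCount_eq_det (fun r i x => walkNum r (x - ρ i) - walkNum r (x + ρ i))
    (fun r i x => ?_) (fun w hw => ?_) (fun r w hw e he => ?_) r w hw
  · simp only [walkNum]
    rw [show x - ρ i - 1 = x - 1 - ρ i by ring, show x - ρ i + 1 = x + 1 - ρ i by ring,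
      show x + ρ i - 1 = x - 1 + ρ i by ring, show x + ρ i + 1 = x + 1 + ρ i by ring]
    ring
  · rw [walkCount_zero hρ, ← det_indicator hρ.1.1 hw.1.1]
    congr 2
    ext i j
    have h1 := hρ.2 i
    have h2 := hw.2 j
    simp only [walkNum, sub_eq_zero]
    rw [if_neg (by omega : ¬ w j + ρ i = 0), sub_zero]
  · by_cases h : StrictAnti (w - fun j => boolStep (e j))
    · obtain ⟨j, hj⟩ : ∃ j, w j - boolStep (e j) ≤ 0 := by
        by_contra! hc
        exact he ⟨⟨h, hw.1.sub_dvd e⟩, hc⟩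
      have h0 : w j - boolStep (e j) = 0 := by
        have := hw.2 j
        rcases boolStep_cases (e j) with h | h <;> rw [h] at hj ⊢ <;> omega
      refine Matrix.det_eq_zero_of_column_eq_zero j fun i => ?_
      rw [Matrix.of_apply, h0, zero_sub, zero_add, walkNum_neg, sub_self]
    · exact hw.1.det_sub_eq_zero (fun i x => walkNum r (x - ρ i) - walkNum r (x + ρ i)) e h

/-- The staircase vector `c - 1, c - 3, c - 5, …`. -/
def stairs (c : ℕ) {k : ℕ} (j : Fin k) : ℤ := c - 1 - 2 * j

theorem stairs_spacedAnti (c k : ℕ) : SpacedAnti (stairs c : Fin k → ℤ) :=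
  ⟨fun i j (h : (i : ℕ) < j) => by simp only [stairs]; omega,
    fun i j => ⟨j - i, by simp only [stairs]; ring⟩⟩

theorem stairs_spacedPos (m : ℕ) : SpacedPos (stairs (2 * m) : Fin m → ℤ) :=
  ⟨stairs_spacedAnti _ _, fun j => by simp only [stairs]; omega⟩

/-- Positions `2 * i` and `2 * i + 1` as the two copies of `Fin m`. -/
noncomputable def pairEquiv (m : ℕ) : Fin m ⊕ Fin m ≃ Fin (2 * m) :=
  Equiv.ofBijective (Sum.elim (fun i => ⟨2 * i, by omega⟩) fun i => ⟨2 * i + 1, by omega⟩) <| by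
    rw [Fintype.bijective_iff_injective_and_card]
    refine ⟨?_, by simp [two_mul]⟩
    rintro (i | i) (j | j) h <;> simp [Fin.ext_iff] at h ⊢ <;> omega

theorem pairEquiv_inl (m : ℕ) (i : Fin m) : pairEquiv m (.inl i) = ⟨2 * i, by omega⟩ := rfl

theorem pairEquiv_inr (m : ℕ) (i : Fin m) : pairEquiv m (.inr i) = ⟨2 * i + 1, by omega⟩ := rfl

/-- Indexing of `stairs (2 * m)` by its negative and its positive values. -/
noncomputable def signEquiv (m : ℕ) : Fin m ⊕ Fin m ≃ Fin (2 * m) :=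
  Equiv.ofBijective (Sum.elim (fun i => ⟨m + i, by omega⟩) fun i => ⟨m - 1 - i, by omega⟩) <| by
    rw [Fintype.bijective_iff_injective_and_card]
    refine ⟨?_, by simp [two_mul]⟩
    rintro (i | i) (j | j) h <;> simp [Fin.ext_iff] at h ⊢ <;> omega

theorem stairs_signEquiv_inl (m : ℕ) (i : Fin m) :
    stairs (2 * m) (signEquiv m (.inl i)) = -(2 * i + 1) := by
  simp only [stairs, signEquiv, Equiv.ofBijective_apply, Sum.elim_inl]; push_cast; ring

theorem stairs_signEquiv_inr (m : ℕ) (i : Fin m) :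
    stairs (2 * m) (signEquiv m (.inr i)) = 2 * i + 1 := by
  simp only [stairs, signEquiv, Equiv.ofBijective_apply, Sum.elim_inr]; omega

/-- The entries of the paired vector determined by its odd-indexed entries. -/
def pairEntry {m : ℕ} (s : Fin m → ℤ) : Fin m ⊕ Fin m → ℤ := Sum.elim (fun i => s i + 2) s

theorem eq_pairEntry_iff {m : ℕ} {w : Fin (2 * m) → ℤ} {s : Fin m → ℤ} :
    w = pairEntry s ∘ (pairEquiv m).symm ↔
      IsPaired w ∧ s = fun i => w (pairEquiv m (.inr i)) := by
  have h1 : w = pairEntry s ∘ (pairEquiv m).symm ↔ w ∘ pairEquiv m = pairEntry s := by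
    rw [Equiv.eq_comp_symm]
  rw [h1, funext_iff, Sum.forall]
  simp only [Function.comp_apply, pairEntry, Sum.elim_inl, Sum.elim_inr]
  constructor
  · rintro ⟨h2, h3⟩
    refine ⟨fun i hi => ⟨by omega, ?_⟩, funext fun i => (h3 i).symm⟩
    have := h2 ⟨i, by omega⟩
    rw [← h3] at this
    exact this
  · rintro ⟨h2, rfl⟩
    exact ⟨fun i => (h2 i (by omega)).2, fun i => rfl⟩

/-- The columns `pairEntry s` of the table of one-walker counts from the staircase. -/
def pairMatrix (m n : ℕ) (s : Fin m → ℤ) : Matrix (Fin (2 * m)) (Fin m ⊕ Fin m) ℤ :=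
  Matrix.of fun i q => walkNum n (pairEntry s q - stairs (2 * m) i)

theorem walkCount_pairEntry {m : ℕ} (n : ℕ) {s : Fin m → ℤ} (hs : StrictAnti s) :
    walkCount SpacedAnti (stairs (2 * m)) n (pairEntry s ∘ (pairEquiv m).symm) =
      ((pairMatrix m n s).submatrix (pairEquiv m) id).det := by
  set w := pairEntry s ∘ (pairEquiv m).symm with hw
  by_cases hC : SpacedAnti w
  · rw [walkCount_spacedAnti (stairs_spacedAnti _ _) _ _ hC,
      ← Matrix.det_submatrix_equiv_self (pairEquiv m)]
    congr 1
    ext p q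
    simp [pairMatrix, hw]
  rw [walkCount_eq_zero hC]
  symm
  by_cases hp : ∀ i, (2 : ℤ) ∣ s i - (2 * m - 1 + n)
  swap
  · obtain ⟨i, hi⟩ := not_forall.1 hp
    refine Matrix.det_eq_zero_of_column_eq_zero (.inr i) fun p => ?_
    refine walkNum_of_parity _ _ ?_
    simp only [pairEntry, stairs, id, Sum.elim_inr]
    omega
  by_cases hg : ∃ i j, s i + 2 = s j
  · obtain ⟨i, j, h⟩ := hg
    refine Matrix.det_zero_of_column_eq (i := .inl i) (j := .inr j) (by simp) fun p => ?_
    simp [pairMatrix, pairEntry, h]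
  refine absurd ⟨?_, ?_⟩ hC
  · intro i j hij
    obtain ⟨p, rfl⟩ := (pairEquiv m).surjective i
    obtain ⟨q, rfl⟩ := (pairEquiv m).surjective j
    simp only [hw, Function.comp_apply, Equiv.symm_apply_apply]
    have key (i j : Fin m) (hij : i < j) : s j + 2 < s i := by
      have h1 := hs hij
      have h2 := hp i
      have h3 := hp j
      have h4 : s j + 2 ≠ s i := fun h => hg ⟨j, i, h⟩
      omega
    rcases p with p | p <;> rcases q with q | q <;>
      simp only [pairEquiv_inl, pairEquiv_inr, Fin.mk_lt_mk] at hij <;>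
      simp only [pairEntry, Sum.elim_inl, Sum.elim_inr]
    · have := hs (Fin.lt_def.2 (by omega) : p < q); omega
    · rcases (Fin.le_def.2 (by omega) : p ≤ q).lt_or_eq with h | h
      · have := hs h; omega
      · rw [h]; omega
    · exact key _ _ (Fin.lt_def.2 (by omega))
    · exact hs (Fin.lt_def.2 (by omega))
  · have key (p) : (2 : ℤ) ∣ pairEntry s p - (2 * m - 1 + n) := by
      rcases p with p | p <;> have := hp p <;>
        simp only [pairEntry, Sum.elim_inl, Sum.elim_inr] <;> omega
    intro i j
    have h1 := key ((pairEquiv m).symm i)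
    have h2 := key ((pairEquiv m).symm j)
    simp only [hw, Function.comp_apply]
    omega

open Classical in
theorem sum_isPaired_eq (m n : ℕ) :
    (∑ E ∈ walksIn SpacedAnti (stairs (2 * m) : Fin (2 * m) → ℤ) n,
      if IsPaired (stairs (2 * m) + walkPos E n) then (1 : ℤ) else 0) =
    ∑ s ∈ Fintype.piFinset fun _ : Fin m => Icc (-(n + 2 * m) : ℤ) (n + 2 * m),
      if StrictAnti s then ((pairMatrix m n s).submatrix (pairEquiv m) id).det else 0 := by
  have h (s : Fin m → ℤ) :
      (if StrictAnti s then ((pairMatrix m n s).submatrix (pairEquiv m) id).det else 0) =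
      ∑ E ∈ walksIn SpacedAnti (stairs (2 * m) : Fin (2 * m) → ℤ) n,
        if StrictAnti s ∧ stairs (2 * m) + walkPos E n = pairEntry s ∘ (pairEquiv m).symm
        then (1 : ℤ) else 0 := by
    split_ifs with hs
    · rw [← walkCount_pairEntry n hs]
      simp [walkCount, hs]
    · simp [hs]
  rw [sum_congr rfl fun s _ => h s, sum_comm]
  refine sum_congr rfl fun E hE => ?_
  have hw := mem_walksIn.1 hE n le_rfl
  simp only [eq_pairEntry_iff]
  split_ifs with hp
  · set s₀ : Fin m → ℤ := fun i =>
      (stairs (2 * m) + walkPos E n : Fin (2 * m) → ℤ) (pairEquiv m (.inr i)) with hs₀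
    have hanti : StrictAnti s₀ := fun i j hij => hw.1 <| by
      rw [pairEquiv_inr, pairEquiv_inr, Fin.mk_lt_mk]
      rw [Fin.lt_def] at hij
      omega
    rw [sum_eq_single_of_mem s₀, if_pos ⟨hanti, hp, rfl⟩]
    · rw [Fintype.mem_piFinset]
      intro i
      have h1 := abs_le.1 (abs_walkPos_le E (pairEquiv m (.inr i)))
      simp only [hs₀, Pi.add_apply, mem_Icc, stairs, pairEquiv_inr] at h1 ⊢
      omega
    · intro s _ hs
      exact if_neg fun h => hs h.2.2
  · simp [hp]

theorem pairEntry_comp {m : ℕ} (s : Fin m → ℤ) (σ : Equiv.Perm (Fin m)) :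
    pairEntry (s ∘ σ) = pairEntry s ∘ σ.sumCongr σ := by
  ext (i | i) <;> rfl

open Classical in
theorem factorial_mul_sum_isPaired (m n : ℕ) :
    (m.factorial : ℤ) * (∑ E ∈ walksIn SpacedAnti (stairs (2 * m) : Fin (2 * m) → ℤ) n,
      if IsPaired (stairs (2 * m) + walkPos E n) then (1 : ℤ) else 0) =
    ∑ s ∈ Fintype.piFinset fun _ : Fin m => Icc (-(n + 2 * m) : ℤ) (n + 2 * m),
      ((pairMatrix m n s).submatrix (pairEquiv m) id).det := by
  rw [sum_isPaired_eq,
    ← sum_piFinset_eq_factorial_mul _ fun s => ((pairMatrix m n s).submatrix (pairEquiv m) id).det]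
  · intro s σ
    have : (pairMatrix m n (s ∘ σ)).submatrix (pairEquiv m) id =
        ((pairMatrix m n s).submatrix (pairEquiv m) id).submatrix id (σ.sumCongr σ) := by
      ext p q
      simp [pairMatrix, pairEntry_comp]
    rw [this, Matrix.det_permute', Equiv.Perm.sign_sumCongr, Int.units_mul_self]
    simp
  · intro s hs
    simp only [Function.Injective, not_forall] at hs
    obtain ⟨i, j, h1, h2⟩ := hs
    refine Matrix.det_zero_of_column_eq (i := .inr i) (j := .inr j) (by simpa using h2)
      fun p => ?_
    simp [pairMatrix, pairEntry, h1]

/-- Row functions spanning the same lattice as the one-walker counts, with isotropic left part. -/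
def isoRow (m n : ℕ) : Fin m ⊕ Fin m → ℤ → ℤ :=
  Sum.elim (fun i z => walkNum n (z - (2 * i + 1)) + walkNum n (z + (2 * i + 1)))
    fun i z => walkNum n (z - (2 * i + 1))

theorem exists_det_pairMatrix (m n : ℕ) : ∃ ε : ℤ, |ε| = 1 ∧ ∀ s,
    ((pairMatrix m n s).submatrix (pairEquiv m) id).det =
      ε * (Matrix.of fun p q => isoRow m n p (pairEntry s q)).det := by
  set σ : Equiv.Perm (Fin m ⊕ Fin m) := (pairEquiv m).trans (signEquiv m).symm with hσ
  refine ⟨Equiv.Perm.sign σ, by rcases Int.units_eq_one_or (Equiv.Perm.sign σ) with h | h <;>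
    rw [h] <;> rfl, fun s => ?_⟩
  have h1 : (pairMatrix m n s).submatrix (pairEquiv m) id =
      ((pairMatrix m n s).submatrix (signEquiv m) id).submatrix σ id := by
    ext p q
    simp [hσ]
  rw [h1, Matrix.det_permute]
  congr 1
  set W := (pairMatrix m n s).submatrix (signEquiv m) id with hW
  have h2 : (Matrix.of fun p q => isoRow m n p (pairEntry s q)) =
      Matrix.fromBlocks 1 1 0 1 * W := by
    rw [← Matrix.fromBlocks_toBlocks W, Matrix.fromBlocks_multiply]
    ext (p | p) (q | q) <;>
      simp [isoRow, hW, pairMatrix, Matrix.toBlocks₁₁, Matrix.toBlocks₁₂, Matrix.toBlocks₂₁,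
        Matrix.toBlocks₂₂, stairs_signEquiv_inl, stairs_signEquiv_inr, add_comm, sub_eq_add_neg]
  rw [h2, Matrix.det_mul, Matrix.det_fromBlocks_zero₂₁]
  simp

/-- The pairing of row functions obtained by summing over one pair of columns. -/
noncomputable def pairing (m n : ℕ) (p q : Fin m ⊕ Fin m) : ℤ :=
  ∑ z ∈ Icc (-(n + 2 * m) : ℤ) (n + 2 * m), isoRow m n p (z + 2) * isoRow m n q z

theorem sum_det_isoRow (m n : ℕ) :
    ∑ s ∈ Fintype.piFinset fun _ : Fin m => Icc (-(n + 2 * m) : ℤ) (n + 2 * m),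
      (Matrix.of fun p q => isoRow m n p (pairEntry s q)).det =
    ∑ σ : Equiv.Perm (Fin m ⊕ Fin m),
      (Equiv.Perm.sign σ : ℤ) * ∏ i, pairing m n (σ (.inl i)) (σ (.inr i)) := by
  simp only [Matrix.det_apply', Matrix.of_apply]
  rw [sum_comm]
  refine sum_congr rfl fun σ _ => ?_
  rw [← mul_sum]
  congr 1
  simp only [pairing]
  rw [prod_univ_sum]
  refine sum_congr rfl fun s _ => ?_
  rw [Fintype.prod_sum_type, ← prod_mul_distrib]
  rfl

theorem sum_walkNum_shift_mul (m n : ℕ) (x y : ℤ) (hy : |y| ≤ 2 * m) :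
    ∑ z ∈ Icc (-(n + 2 * m) : ℤ) (n + 2 * m), walkNum n (z + 2 - x) * walkNum n (z - y) =
      walkNum (2 * n) (x - y - 2) := by
  have h := sum_walkNum_mul (Icc (-(n + 2 * m) : ℤ) (n + 2 * m)) n (fun z => walkNum n (z - y)) n y
    (fun _ => rfl) (fun z hz => walkNum_of_lt_abs _ _ ?_) (x - 2)
  · rw [two_mul n, show x - y - 2 = x - 2 - y by ring, ← h]
    refine sum_congr rfl fun z _ => ?_
    rw [← walkNum_neg n (z + 2 - x)]
    congr 2
    ring
  · rw [mem_Icc, not_and_or] at hz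
    rw [abs_le] at hy
    rw [lt_abs]
    omega

theorem det_eq_of_consecutive {m : ℕ} (L : ℤ → Fin m → ℤ) (hL : L (-1) = 0) :
    |(Matrix.of fun i j : Fin m => L ((i : ℤ) - 1) j - L i j).det| =
      |(Matrix.of fun i j : Fin m => L ((i : ℤ) - 1) j + L i j).det| := by
  cases m with
  | zero => simp
  | succ m =>
    have h1 : (Matrix.of fun i j : Fin (m + 1) => L i j).det =
        (-Matrix.of fun i j : Fin (m + 1) => L ((i : ℤ) - 1) j - L i j).det := by
      refine Matrix.det_eq_of_forall_row_eq_smul_add_pred (fun _ => 1) (fun j => ?_)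
        fun i j => ?_
      · simp [hL]
      · simp
    have h2 : (Matrix.of fun i j : Fin (m + 1) => L i j).det =
        (Matrix.of fun i j : Fin (m + 1) => L ((i : ℤ) - 1) j + L i j).det := by
      refine Matrix.det_eq_of_forall_row_eq_smul_add_pred (fun _ => -1) (fun j => ?_)
        fun i j => ?_
      · simp [hL]
      · simp
    rw [← h2, h1, Matrix.det_neg, abs_mul]
    simp

theorem pairing_inl_inl (m n : ℕ) (i j : Fin m) :
    pairing m n (.inl i) (.inl j) = pairing m n (.inl j) (.inl i) := by
  have h (i j : Fin m) : pairing m n (.inl i) (.inl j) =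
      walkNum (2 * n) (2 * i - 2 * j - 2) + walkNum (2 * n) (2 * i + 2 * j) +
        (walkNum (2 * n) (2 * i + 2 * j + 4) + walkNum (2 * n) (2 * j - 2 * i - 2)) := by
    have e1 := sum_walkNum_shift_mul m n (2 * i + 1) (2 * j + 1) (by rw [abs_le]; omega)
    have e2 := sum_walkNum_shift_mul m n (2 * i + 1) (-(2 * j + 1)) (by rw [abs_le]; omega)
    have e3 := sum_walkNum_shift_mul m n (-(2 * i + 1)) (2 * j + 1) (by rw [abs_le]; omega)
    have e4 := sum_walkNum_shift_mul m n (-(2 * i + 1)) (-(2 * j + 1)) (by rw [abs_le]; omega)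
    rw [← walkNum_neg] at e3
    simp only [pairing, isoRow, Sum.elim_inl, add_mul, mul_add, sum_add_distrib, sub_neg_eq_add]
      at e1 e2 e3 e4 ⊢
    rw [e1, e2, e3, e4]
    ring_nf
  rw [h, h]
  ring_nf

theorem pairing_sub_pairing (m n : ℕ) (i j : Fin m) :
    pairing m n (.inl i) (.inr j) - pairing m n (.inr j) (.inl i) =
      walkNum (2 * n) (2 * i - 2 * j - 2) + walkNum (2 * n) (2 * i + 2 * j + 4) -
        (walkNum (2 * n) (2 * i - 2 * j + 2) + walkNum (2 * n) (2 * i + 2 * j)) := by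
  have e1 := sum_walkNum_shift_mul m n (2 * i + 1) (2 * j + 1) (by rw [abs_le]; omega)
  have e2 := sum_walkNum_shift_mul m n (-(2 * i + 1)) (2 * j + 1) (by rw [abs_le]; omega)
  have e3 := sum_walkNum_shift_mul m n (2 * j + 1) (2 * i + 1) (by rw [abs_le]; omega)
  have e4 := sum_walkNum_shift_mul m n (2 * j + 1) (-(2 * i + 1)) (by rw [abs_le]; omega)
  rw [← walkNum_neg] at e2 e3
  simp only [pairing, isoRow, Sum.elim_inl, Sum.elim_inr, add_mul, mul_add, sum_add_distrib,
    sub_neg_eq_add] at e1 e2 e3 e4 ⊢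
  rw [e1, e2, e3, e4]
  ring_nf

open Classical in
theorem abs_sum_isPaired (m n : ℕ) :
    |∑ E ∈ walksIn SpacedAnti (stairs (2 * m) : Fin (2 * m) → ℤ) n,
      if IsPaired (stairs (2 * m) + walkPos E n) then (1 : ℤ) else 0| =
    |(Matrix.of fun i j : Fin m =>
      pairing m n (.inl i) (.inr j) - pairing m n (.inr j) (.inl i)).det| := by
  obtain ⟨ε, hε, h⟩ := exists_det_pairMatrix m n
  have h1 := factorial_mul_sum_isPaired m n
  simp only [h, ← mul_sum] at h1
  rw [sum_det_isoRow, sum_sign_prod_isotropic _ (pairing_inl_inl m n), Fintype.card_fin,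
    mul_left_comm] at h1
  rw [mul_left_cancel₀ (Int.natCast_ne_zero.2 m.factorial_ne_zero) h1, abs_mul, hε, one_mul]

theorem walkCount_nonneg {k : ℕ} (C : (Fin k → ℤ) → Prop) (ρ : Fin k → ℤ) (r : ℕ) (w : Fin k → ℤ) :
    0 ≤ walkCount C ρ r w :=
  sum_nonneg fun _ _ => by split_ifs <;> simp

theorem walkCount_spacedPos_stairs (m r : ℕ) :
    walkCount SpacedPos (stairs (2 * m)) r (stairs (2 * m) : Fin m → ℤ) =
      (Matrix.of fun i j : Fin m =>
        walkNum r (2 * i - 2 * j) - walkNum r (2 * i + 2 * j + 2)).det := by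
  rw [walkCount_spacedPos (stairs_spacedPos m) _ _ (stairs_spacedPos m),
    ← Matrix.det_submatrix_equiv_self Fin.revPerm]
  congr 1
  ext i j
  simp only [Matrix.submatrix_apply, Matrix.of_apply, stairs, Fin.revPerm_apply, Fin.val_rev]
  rw [Nat.cast_sub (by omega), Nat.cast_sub (by omega), ← walkNum_neg]
  congr 2 <;> push_cast <;> ring

open Classical in
/-- Paired endpoints of unrestricted walkers are equinumerous with closed positive walks. -/
theorem sum_isPaired_eq_walkCount (m n : ℕ) :
    (∑ E ∈ walksIn SpacedAnti (stairs (2 * m) : Fin (2 * m) → ℤ) n,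
      if IsPaired (stairs (2 * m) + walkPos E n) then (1 : ℤ) else 0) =
    walkCount SpacedPos (stairs (2 * m)) (2 * n + 2) (stairs (2 * m) : Fin m → ℤ) := by
  have h0 : (0 : ℤ) ≤ ∑ E ∈ walksIn SpacedAnti (stairs (2 * m) : Fin (2 * m) → ℤ) n,
      if IsPaired (stairs (2 * m) + walkPos E n) then (1 : ℤ) else 0 :=
    sum_nonneg fun E _ => by split_ifs <;> simp
  rw [← abs_of_nonneg (walkCount_nonneg SpacedPos (stairs (2 * m)) (2 * n + 2) _),
    ← abs_of_nonneg h0, abs_sum_isPaired, walkCount_spacedPos_stairs]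
  let K : ℤ → Fin m → ℤ := fun x j =>
    walkNum (2 * n) (x - (2 * j + 1)) - walkNum (2 * n) (x + (2 * j + 1))
  have h := det_eq_of_consecutive (m := m) (fun i j => K (2 * i + 1) j + K (2 * i + 3) j) ?_
  · refine Eq.trans (congrArg (fun X => |Matrix.det X|) ?_)
      (h.trans (congrArg (fun X => |Matrix.det X|) ?_))
    · ext i j
      simp only [Matrix.of_apply, K, pairing_sub_pairing]
      ring_nf
    · ext i j
      simp only [Matrix.of_apply, K, walkNum]
      ring_nf
  · ext j
    have h1 := walkNum_neg (2 * n) (1 + (2 * j + 1))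
    have h2 := walkNum_neg (2 * n) (1 - (2 * j + 1))
    simp only [K, Pi.zero_apply]
    ring_nf at h1 h2 ⊢
    linarith

/-- A family of paths starting at `0` whose first `r` steps are `1` or `-1`. -/
def IsStepPath {c : ℕ} (r : ℕ) (x : ℕ → Fin c → ℤ) : Prop :=
  x 0 = 0 ∧ ∀ t < r, ∀ k, x (t + 1) k = x t k + 1 ∨ x (t + 1) k = x t k - 1

theorem isStepPath_walkPos {r c : ℕ} (E : Fin r → Fin c → Bool) : IsStepPath r (walkPos E) := by
  refine ⟨walkPos_zero E, fun t ht k => ?_⟩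
  rw [walkPos_succ E ht]
  rcases boolStep_cases (E ⟨t, ht⟩ k) with h | h <;> simp [h, sub_eq_add_neg]

theorem IsStepPath.exists_walkPos_eq {r c : ℕ} {x : ℕ → Fin c → ℤ} (hx : IsStepPath r x) :
    ∃ E : Fin r → Fin c → Bool, ∀ t ≤ r, walkPos E t = x t := by
  refine ⟨fun s k => decide (x (s + 1) k = x s k + 1), fun t ht => ?_⟩
  induction t with
  | zero => rw [walkPos_zero, hx.1]
  | succ t ih =>
    ext k
    rw [walkPos_succ _ (by omega), ih (by omega)]
    rcases hx.2 t (by omega) k with h | h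
    · simp [h, boolStep]
    · simp [h, boolStep]
      omega

theorem walkPos_injective {r c : ℕ} {E F : Fin r → Fin c → Bool}
    (h : ∀ t ≤ r, walkPos E t = walkPos F t) : E = F := by
  ext s k : 2
  have h1 := congrFun (h (s + 1) s.2) k
  rw [walkPos_succ E s.2, walkPos_succ F s.2, h s s.2.le] at h1
  have h2 := add_left_cancel h1
  simp only [Fin.eta] at h2
  cases hE : E s k <;> cases hF : F s k <;> simp_all [boolStep]

theorem IsStepPath.abs_sub_le {r c : ℕ} {x : ℕ → Fin c → ℤ} (hx : IsStepPath r x) {t : ℕ} (d : ℕ)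
    (h : t + d ≤ r) (k : Fin c) : |x (t + d) k - x t k| ≤ d := by
  induction d with
  | zero => simp
  | succ d ih =>
    have h1 := abs_le.1 (ih (by omega))
    rw [abs_le, ← add_assoc]
    rcases hx.2 (t + d) (by omega) k with h | h <;> rw [h] <;> push_cast <;> omega

theorem IsStepPath.two_dvd {r c : ℕ} {x : ℕ → Fin c → ℤ} (hx : IsStepPath r x) {t : ℕ}
    (h : t ≤ r) (k : Fin c) : (2 : ℤ) ∣ x t k - t := by
  induction t with
  | zero => simp [hx.1]
  | succ t ih =>
    have := ih (by omega)
    rcases hx.2 t (by omega) k with h | h <;> rw [h] <;> push_cast <;> omega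

/-- A family of paths that start and end at `0` and make `2 * a` steps. -/
def IsClosedPath {c : ℕ} (a : ℕ) (x : ℕ → Fin c → ℤ) : Prop :=
  IsStepPath (2 * a) x ∧ x (2 * a) = 0

theorem IsClosedPath.bounds {a c : ℕ} {x : ℕ → Fin c → ℤ} (hx : IsClosedPath a x) {t : ℕ}
    (h : t ≤ 2 * a) (k : Fin c) :
    -(t : ℤ) ≤ x t k ∧ x t k ≤ t ∧ -(2 * a - t : ℤ) ≤ x t k ∧ x t k ≤ 2 * a - t := by
  have h1 := hx.1.abs_sub_le (t := 0) t (by omega) k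
  have h2 := hx.1.abs_sub_le (t := t) (2 * a - t) (by omega) k
  rw [zero_add, hx.1.1] at h1
  rw [Nat.add_sub_cancel' h, hx.2] at h2
  rw [abs_le] at h1 h2
  simp only [Pi.zero_apply] at h1 h2
  omega

/-- The set of cubes below a family of paths, the path at level `k` being the boundary of the
`k`-th layer read along the diagonals. -/
def belowPath (a c : ℕ) (x : ℕ → Fin c → ℤ) : Finset (Fin a × Fin a × Fin c) :=
  univ.filter fun p => (p.1 : ℤ) + p.2.1 - a < x (a + p.2.1 - p.1) p.2.2

theorem mem_belowPath {a c : ℕ} {x : ℕ → Fin c → ℤ} {p : Fin a × Fin a × Fin c} :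
    p ∈ belowPath a c x ↔ (p.1 : ℤ) + p.2.1 - a < x (a + p.2.1 - p.1) p.2.2 := by
  simp [belowPath]

theorem isPP_belowPath {a c : ℕ} {x : ℕ → Fin c → ℤ} (hx : IsStepPath (2 * a) x)
    (hanti : ∀ t ≤ 2 * a, Antitone (x t)) : IsPP a a c (belowPath a c x) := by
  rintro ⟨i, j, k⟩ hp ⟨i', j', k'⟩ hi hj hk
  rw [mem_belowPath] at hp ⊢
  dsimp only at *
  rw [Fin.le_def] at hi hj
  have h1 := hanti (a + j' - i') (by omega) hk
  rcases le_total (a + j - i : ℕ) (a + j' - i') with h | h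
  · have h2 := hx.abs_sub_le (t := a + j - i) ((a + j' - i') - (a + j - i)) (by omega) k
    rw [Nat.add_sub_cancel' h, abs_le] at h2
    omega
  · have h2 := hx.abs_sub_le (t := a + j' - i') ((a + j - i) - (a + j' - i')) (by omega) k
    rw [Nat.add_sub_cancel' h, abs_le] at h2
    omega

theorem belowPath_injective {a c : ℕ} {x y : ℕ → Fin c → ℤ} (hx : IsClosedPath a x)
    (hy : IsClosedPath a y) (h : belowPath a c x = belowPath a c y) {t : ℕ} (ht : t ≤ 2 * a) :
    x t = y t := by
  have key {x y : ℕ → Fin c → ℤ} (hx : IsClosedPath a x) (hy : IsClosedPath a y)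
      (h : belowPath a c x = belowPath a c y) (k : Fin c) : y t k ≤ x t k := by
    by_contra! hlt
    have hbx := hx.bounds ht k
    have hby := hy.bounds ht k
    obtain ⟨d, hd⟩ := hx.1.two_dvd ht k
    have h1 := Finset.ext_iff.1 h (⟨(d + a).toNat, by omega⟩, ⟨(d + t).toNat, by omega⟩, k)
    simp only [mem_belowPath] at h1
    rw [show a + (d + t).toNat - (d + a).toNat = t by omega] at h1
    omega
  ext k
  exact le_antisymm (key hy hx h.symm k) (key hx hy h k)

theorem exists_threshold (N : ℕ) (P : ℕ → Prop) (hP : ∀ i j, i ≤ j → P j → P i) :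
    ∃ h ≤ N, ∀ i < N, i < h ↔ P i := by
  induction N with
  | zero => exact ⟨0, le_rfl, by simp⟩
  | succ N ih =>
    obtain ⟨h, hN, hh⟩ := ih
    by_cases hPN : P N
    · exact ⟨N + 1, le_rfl, fun i hi => iff_of_true hi (hP i N (by omega) hPN)⟩
    · refine ⟨h, by omega, fun i hi => ?_⟩
      rcases Nat.lt_succ_iff_lt_or_eq.1 hi with h' | rfl
      · exact hh i h'
      · exact iff_of_false (by omega) hPN

theorem exists_eq_belowPath {a c : ℕ} {T : Finset (Fin a × Fin a × Fin c)} (hT : IsPP a a c T) :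
    ∃ x : ℕ → Fin c → ℤ, IsClosedPath a x ∧ (∀ t, Antitone (x t)) ∧ T = belowPath a c x := by
  let P (i j : ℕ) (k : Fin c) : Prop := ∃ (hi : i < a) (hj : j < a), (⟨i, hi⟩, ⟨j, hj⟩, k) ∈ T
  have hP {i j i' j' : ℕ} {k k' : Fin c} (h : P i j k) (hi : i' ≤ i) (hj : j' ≤ j)
      (hk : k' ≤ k) : P i' j' k' := by
    obtain ⟨h1, h2, h3⟩ := h
    exact ⟨by omega, by omega, hT _ h3 _ hi hj hk⟩
  have hex (t : ℕ) (k : Fin c) := exists_threshold (min t (2 * a - t))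
    (fun s => P (s + (a - t)) (s + (t - a)) k)
    fun s s' hs h => hP h (by omega) (by omega) le_rfl
  choose h hle hiff using hex
  refine ⟨fun t k => 2 * h t k - (min t (2 * a - t) : ℕ), ⟨⟨?_, fun t ht k => ?_⟩, ?_⟩, ?_, ?_⟩
  · ext k
    have := hle 0 k
    simp only [Pi.zero_apply]
    omega
  · have h1 := hle t k
    have h2 := hle (t + 1) k
    rcases Nat.lt_or_ge t a with hta | hta
    · have h3 : h t k ≤ h (t + 1) k := by
        by_contra! hlt
        have := (hiff t k (h (t + 1) k) (by omega)).1 hlt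
        have := (hiff (t + 1) k (h (t + 1) k) (by omega)).2
          (hP this (by omega) (by omega) le_rfl)
        omega
      have h4 : h (t + 1) k ≤ h t k + 1 := by
        by_contra! hlt
        have := (hiff (t + 1) k (h t k + 1) (by omega)).1 hlt
        have := (hiff t k (h t k) (by omega)).2 (hP this (by omega) (by omega) le_rfl)
        omega
      dsimp only
      omega
    · have h3 : h (t + 1) k ≤ h t k := by
        by_contra! hlt
        have := (hiff (t + 1) k (h t k) (by omega)).1 hlt
        have := (hiff t k (h t k) (by omega)).2 (hP this (by omega) (by omega) le_rfl)
        omega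
      have h4 : h t k ≤ h (t + 1) k + 1 := by
        by_contra! hlt
        have := (hiff t k (h (t + 1) k + 1) (by omega)).1 hlt
        have := (hiff (t + 1) k (h (t + 1) k) (by omega)).2
          (hP this (by omega) (by omega) le_rfl)
        omega
      dsimp only
      omega
  · ext k
    have := hle (2 * a) k
    simp only [Pi.zero_apply]
    omega
  · intro t k k' hk
    have : h t k' ≤ h t k := by
      by_contra! hlt
      have h1 := hle t k'
      have := (hiff t k' (h t k) (by omega)).1 hlt
      have := (hiff t k (h t k) (by omega)).2 (hP this le_rfl le_rfl hk)
      omega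
    dsimp only
    omega
  · ext ⟨i, j, k⟩
    rw [mem_belowPath]
    have h1 := hiff (a + j - i) k (min i j) (by omega)
    rw [show min (i : ℕ) j + (a - (a + j - i)) = i by omega,
      show min (i : ℕ) j + ((a + j - i) - a) = j by omega] at h1
    have h2 : P i j k ↔ (i, j, k) ∈ T := ⟨fun ⟨_, _, h⟩ => h, fun h => ⟨i.2, j.2, h⟩⟩
    rw [← h2, ← h1]
    dsimp only
    omega

theorem mem_ppTau {a c : ℕ} {T : Finset (Fin a × Fin a × Fin c)} {p : Fin a × Fin a × Fin c} :
    p ∈ ppTau a c T ↔ (p.2.1, p.1, p.2.2) ∈ T := by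
  simp only [ppTau, mem_image]
  constructor
  · rintro ⟨q, hq, rfl⟩
    exact hq
  · exact fun h => ⟨_, h, rfl⟩

theorem ppTau_belowPath {a c : ℕ} (x : ℕ → Fin c → ℤ) :
    ppTau a c (belowPath a c x) = belowPath a c fun t => x (2 * a - t) := by
  ext ⟨i, j, k⟩
  rw [mem_ppTau, mem_belowPath, mem_belowPath]
  dsimp only
  rw [show 2 * a - (a + j - i : ℕ) = a + i - j by omega, add_comm (j : ℤ)]

theorem ppKappa_ppTau_belowPath {a c : ℕ} {x : ℕ → Fin c → ℤ} (hx : IsStepPath (2 * a) x) :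
    ppKappa a a c (ppTau a c (belowPath a c x)) = belowPath a c fun t k => -x t k.rev := by
  ext ⟨i, j, k⟩
  simp only [ppKappa, mem_filter, mem_univ, true_and, mem_ppTau, mem_belowPath, Fin.val_rev]
  rw [show a + (a - (i + 1)) - (a - (j + 1)) = a + (j : ℕ) - i by omega]
  have h := hx.two_dvd (t := a + j - i) (by omega) k.rev
  omega

theorem IsClosedPath.reflect {a c : ℕ} {x : ℕ → Fin c → ℤ} (hx : IsClosedPath a x) :
    IsClosedPath a fun t => x (2 * a - t) := by
  refine ⟨⟨hx.2, fun t ht k => ?_⟩, by simpa using hx.1.1⟩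
  have := hx.1.2 (2 * a - (t + 1)) (by omega) k
  rw [show 2 * a - (t + 1) + 1 = 2 * a - t by omega] at this
  dsimp only
  omega

theorem IsClosedPath.neg_rev {a c : ℕ} {x : ℕ → Fin c → ℤ} (hx : IsClosedPath a x) :
    IsClosedPath a fun t k => -x t k.rev := by
  refine ⟨⟨?_, fun t ht k => ?_⟩, ?_⟩
  · ext k; simp [hx.1.1]
  · have := hx.1.2 t ht k.rev
    dsimp only
    omega
  · ext k; simp [hx.2]

theorem SpacedAnti.add_le {k : ℕ} {w : Fin k → ℤ} (hw : SpacedAnti w) {i j : Fin k}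
    (hij : i ≤ j) : w j + 2 * ((j : ℤ) - i) ≤ w i := by
  obtain ⟨d, hd⟩ := Nat.exists_eq_add_of_le (Fin.le_def.1 hij)
  induction d generalizing j with
  | zero =>
    obtain rfl : j = i := Fin.ext hd
    simp
  | succ d ih =>
    have h1 := ih (j := ⟨i + d, by omega⟩) (Fin.le_def.2 (by simp)) rfl
    have h2 := hw.gap (i := ⟨i + d, by omega⟩) (j := j) (Fin.lt_def.2 (by simp; omega))
    push_cast at h1
    omega

theorem spacedAnti_stairs_add_iff {c k : ℕ} {x : Fin k → ℤ} (hx : ∀ i j, (2 : ℤ) ∣ x i - x j) :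
    SpacedAnti (stairs c + x) ↔ Antitone x := by
  constructor
  · intro h i j hij
    have := h.add_le hij
    simp only [Pi.add_apply, stairs] at this
    omega
  · intro h
    refine ⟨fun i j hij => ?_, fun i j => ?_⟩
    · have h1 := h hij.le
      have h2 := Fin.lt_def.1 hij
      simp only [Pi.add_apply, stairs]
      omega
    · have := hx i j
      simp only [Pi.add_apply, stairs]
      omega

theorem two_dvd_walkPos_sub {r c : ℕ} (E : Fin r → Fin c → Bool) {t : ℕ} (ht : t ≤ r)
    (i j : Fin c) : (2 : ℤ) ∣ walkPos E t i - walkPos E t j := by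
  have h1 := (isStepPath_walkPos E).two_dvd ht i
  have h2 := (isStepPath_walkPos E).two_dvd ht j
  omega

/-- The palindromic closed path whose first half is the walk `E`. -/
def palindrome {a c : ℕ} (E : Fin a → Fin c → Bool) (t : ℕ) : Fin c → ℤ :=
  walkPos E (min t (2 * a - t))

theorem palindrome_of_le {a c : ℕ} (E : Fin a → Fin c → Bool) {t : ℕ} (ht : t ≤ a) :
    palindrome E t = walkPos E t := by
  rw [palindrome, min_eq_left (by omega)]

theorem palindrome_reflect {a c : ℕ} (E : Fin a → Fin c → Bool) {t : ℕ} (ht : t ≤ 2 * a) :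
    palindrome E (2 * a - t) = palindrome E t := by
  rw [palindrome, palindrome, Nat.sub_sub_self ht, min_comm]

theorem isClosedPath_palindrome {a c : ℕ} (E : Fin a → Fin c → Bool) :
    IsClosedPath a (palindrome E) := by
  have h0 : palindrome E 0 = 0 := by rw [palindrome_of_le E (Nat.zero_le a), walkPos_zero]
  refine ⟨⟨h0, fun t ht k => ?_⟩, by rw [← palindrome_reflect E le_rfl, Nat.sub_self, h0]⟩
  have hs := (isStepPath_walkPos E).2
  rcases Nat.lt_or_ge t a with hta | hta
  · rw [palindrome_of_le E hta.le, palindrome_of_le E hta]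
    exact hs t hta k
  · have ht' : t + 1 ≤ 2 * a := ht
    rw [← palindrome_reflect E ht.le, ← palindrome_reflect E ht',
      palindrome_of_le E (by omega), palindrome_of_le E (by omega)]
    have := hs (2 * a - (t + 1)) (by omega) k
    rw [show 2 * a - (t + 1) + 1 = 2 * a - t by omega] at this
    omega

theorem belowPath_congr {a c : ℕ} {x y : ℕ → Fin c → ℤ} (h : ∀ t ≤ 2 * a, x t = y t) :
    belowPath a c x = belowPath a c y := by
  ext ⟨i, j, k⟩
  rw [mem_belowPath, mem_belowPath]
  dsimp only
  rw [h _ (by omega)]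

/-- Off-diagonal cubes of a symmetric set cancel in pairs. -/
theorem neg_one_pow_card_of_symm {a c : ℕ} {T : Finset (Fin a × Fin a × Fin c)}
    (hT : ppTau a c T = T) :
    (-1 : ℤ) ^ #T = ∏ k, ∏ i, if (i, i, k) ∈ T then (-1 : ℤ) else 1 := by
  have hswap {p : Fin a × Fin a × Fin c} (hp : p ∈ T) : (p.2.1, p.1, p.2.2) ∈ T := by
    rwa [← hT, mem_ppTau] at hp
  rw [← prod_const, ← prod_filter_mul_prod_filter_not T fun p => p.1 = p.2.1]
  have h1 : ∏ p ∈ T with ¬ p.1 = p.2.1, (-1 : ℤ) = 1 := by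
    refine prod_involution (fun p _ => (p.2.1, p.1, p.2.2)) (fun _ _ => by norm_num)
      (fun p hp _ h => (mem_filter.1 hp).2 (congrArg (fun q => q.2.1) h))
      (fun p hp => ?_) fun _ _ => rfl
    rw [mem_filter] at hp ⊢
    exact ⟨hswap hp.1, fun h => hp.2 h.symm⟩
  rw [h1, mul_one, prod_comm, ← Fintype.prod_prod_type', prod_ite, prod_const_one, mul_one]
  refine prod_nbij' (fun p => (p.1, p.2.2)) (fun p => (p.1, p.1, p.2)) ?_ ?_ ?_ ?_ fun _ _ => rfl
  · rintro ⟨i, j, k⟩ hp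
    simp only [mem_filter] at hp
    obtain ⟨hp, rfl⟩ := hp
    simpa using hp
  · rintro ⟨i, k⟩ hp
    simpa using hp
  · rintro ⟨i, j, k⟩ hp
    simp only [mem_filter] at hp
    obtain ⟨hp, rfl⟩ := hp
    rfl
  · rintro ⟨i, k⟩ _
    rfl

theorem ppTau_palindrome {a c : ℕ} (E : Fin a → Fin c → Bool) :
    ppTau a c (belowPath a c (palindrome E)) = belowPath a c (palindrome E) := by
  rw [ppTau_belowPath]
  exact belowPath_congr fun t ht => palindrome_reflect E ht

theorem neg_one_pow_card_palindrome {a c : ℕ} (E : Fin a → Fin c → Bool) :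
    (-1 : ℤ) ^ #(belowPath a c (palindrome E)) = ∏ j, ∏ s, -boolStep (E s j) := by
  rw [neg_one_pow_card_of_symm (ppTau_palindrome E)]
  refine prod_congr rfl fun k _ => ?_
  rw [prod_neg_boolStep, prod_ite, prod_const_one, mul_one, prod_const]
  congr 1
  have hle : #{s | E s k = true} ≤ a := (card_le_univ _).trans (by simp)
  have h (i : Fin a) :
      (i, i, k) ∈ belowPath a c (palindrome E) ↔ (i : ℕ) < #{s | E s k = true} := by
    rw [mem_belowPath]
    dsimp only
    rw [Nat.add_sub_cancel, palindrome_of_le E le_rfl, walkPos_eq_card]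
    omega
  simp only [h]
  rw [Fin.card_filter_val_lt, min_eq_right hle]

theorem sum_symmetric_eq (a c : ℕ) :
    ∑ T ∈ univ.filter fun T : Finset (Fin a × Fin a × Fin c) => IsPP a a c T ∧ ppTau a c T = T,
      (-1 : ℤ) ^ #T =
    ∑ E ∈ walksIn SpacedAnti (stairs c : Fin c → ℤ) a, ∏ j, ∏ s, -boolStep (E s j) := by
  symm
  refine sum_nbij (fun E => belowPath a c (palindrome E)) (fun E hE => ?_) (fun E _ F _ h => ?_)
    (fun T hT => ?_) fun E _ => (neg_one_pow_card_palindrome E).symm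
  · refine mem_filter.2 ⟨mem_univ _, isPP_belowPath (isClosedPath_palindrome E).1 fun t _ => ?_,
      ppTau_palindrome E⟩
    have ht : min t (2 * a - t) ≤ a := by omega
    exact (spacedAnti_stairs_add_iff (two_dvd_walkPos_sub E ht)).1 (mem_walksIn.1 hE _ ht)
  · refine walkPos_injective fun t ht => ?_
    rw [← palindrome_of_le E ht, ← palindrome_of_le F ht]
    exact belowPath_injective (isClosedPath_palindrome E) (isClosedPath_palindrome F) h (by omega)
  · obtain ⟨-, hPP, hsymm⟩ := mem_filter.1 hT
    obtain ⟨x, hx, hanti, rfl⟩ := exists_eq_belowPath hPP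
    rw [ppTau_belowPath] at hsymm
    have hrefl {t : ℕ} (ht : t ≤ 2 * a) : x (2 * a - t) = x t :=
      belowPath_injective hx.reflect hx hsymm ht
    obtain ⟨E, hE⟩ := IsStepPath.exists_walkPos_eq (r := a)
      ⟨hx.1.1, fun t ht => hx.1.2 t (by omega)⟩
    refine ⟨E, mem_coe.2 (mem_walksIn.2 fun t ht => ?_), belowPath_congr fun t ht => ?_⟩
    · rw [spacedAnti_stairs_add_iff (two_dvd_walkPos_sub E ht), hE t ht]
      exact hanti t
    · rcases le_total t a with h | h
      · rw [palindrome_of_le E h, hE t h]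
      · rw [← palindrome_reflect E ht, palindrome_of_le E (by omega), hE _ (by omega), hrefl ht]

/-- The extension of paths on the first `m` levels to an antisymmetric family on `2 * m`
levels. -/
def antiExtend {m : ℕ} (x : ℕ → Fin m → ℤ) (t : ℕ) (k : Fin (2 * m)) : ℤ :=
  if h : (k : ℕ) < m then x t ⟨k, h⟩ else -x t ⟨k.rev, by rw [Fin.val_rev]; omega⟩

theorem antiExtend_rev {m : ℕ} (x : ℕ → Fin m → ℤ) (t : ℕ) (k : Fin (2 * m)) :
    -antiExtend x t k.rev = antiExtend x t k := by
  simp only [antiExtend, Fin.rev_rev, Fin.val_rev]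
  by_cases h : (k : ℕ) < m
  · rw [dif_pos h, dif_neg (by omega), neg_neg]
  · rw [dif_neg h, dif_pos (by omega)]

theorem IsClosedPath.antiExtend {a m : ℕ} {x : ℕ → Fin m → ℤ} (hx : IsClosedPath a x) :
    IsClosedPath a (antiExtend x) := by
  refine ⟨⟨?_, fun t ht k => ?_⟩, ?_⟩
  · ext k; simp [_root_.antiExtend, hx.1.1]
  · simp only [_root_.antiExtend]
    split_ifs
    · exact hx.1.2 t ht _
    · have := hx.1.2 t ht ⟨k.rev, by rw [Fin.val_rev]; omega⟩
      omega
  · ext k; simp [_root_.antiExtend, hx.2]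

theorem antitone_antiExtend_iff {m : ℕ} {x : ℕ → Fin m → ℤ} {t : ℕ} :
    Antitone (antiExtend x t) ↔ Antitone (x t) ∧ ∀ k, 0 ≤ x t k := by
  constructor
  · intro h
    have hlow (k : Fin m) : antiExtend x t ⟨k, by omega⟩ = x t k := by simp [antiExtend]
    refine ⟨fun i j hij => ?_, fun k => ?_⟩
    · rw [← hlow, ← hlow]
      exact h (Fin.le_def.2 hij)
    · have h1 := antiExtend_rev x t ⟨k, by omega⟩
      have h2 := @h ⟨k, by omega⟩ (Fin.rev ⟨k, by omega⟩)
        (Fin.le_def.2 (by rw [Fin.val_rev]; dsimp only; omega))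
      rw [hlow] at h1 h2
      omega
  · rintro ⟨h1, h2⟩ i j hij
    rw [Fin.le_def] at hij
    simp only [antiExtend]
    split_ifs with hj hi hi
    · exact h1 (Fin.le_def.2 hij)
    · omega
    · have := h2 ⟨i, hi⟩
      have := h2 ⟨j.rev, by rw [Fin.val_rev]; omega⟩
      omega
    · refine neg_le_neg (h1 (Fin.le_def.2 ?_))
      simp only [Fin.val_rev]
      omega

theorem spacedPos_stairs_add_iff {m : ℕ} {x : Fin m → ℤ} (hx : ∀ i j, (2 : ℤ) ∣ x i - x j) :
    SpacedPos (stairs (2 * m) + x) ↔ Antitone x ∧ ∀ k, 0 ≤ x k := by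
  rw [SpacedPos, spacedAnti_stairs_add_iff hx]
  refine and_congr_right fun hanti => ⟨fun h k => ?_, fun h k => ?_⟩
  · have hm : m - 1 < m := by have := k.2; omega
    have h1 := h ⟨m - 1, hm⟩
    have h2 := @hanti k ⟨m - 1, hm⟩ (Fin.le_def.2 (by dsimp only; omega))
    simp only [Pi.add_apply, stairs] at h1
    omega
  · have := h k
    simp only [Pi.add_apply, stairs]
    omega

theorem card_transposeComplement_even (a m : ℕ) :
    ((univ.filter fun T : Finset (Fin a × Fin a × Fin (2 * m)) =>
      IsPP a a (2 * m) T ∧ ppKappa a a (2 * m) (ppTau a (2 * m) T) = T).card : ℤ) =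
    walkCount SpacedPos (stairs (2 * m)) (2 * a) (stairs (2 * m) : Fin m → ℤ) := by
  classical
  rw [walkCount, sum_boole, Nat.cast_inj]
  symm
  have hclosed {E : Fin (2 * a) → Fin m → Bool}
      (hE : stairs (2 * m) + walkPos E (2 * a) = stairs (2 * m)) : IsClosedPath a (walkPos E) :=
    ⟨isStepPath_walkPos E, add_eq_left.1 hE⟩
  have hinj {x y : ℕ → Fin m → ℤ} {t : ℕ} (h : antiExtend x t = antiExtend y t) : x t = y t := by
    ext k
    simpa [antiExtend] using congrFun h ⟨k, by omega⟩
  refine card_nbij (fun E => belowPath a (2 * m) (antiExtend (walkPos E))) (fun E hE => ?_)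
    (fun E hE F hF h => ?_) fun T hT => ?_
  · obtain ⟨hE, hend⟩ := mem_filter.1 hE
    have hx := (hclosed hend).antiExtend
    refine mem_filter.2 ⟨mem_univ _, isPP_belowPath hx.1 fun t ht => ?_, ?_⟩
    · rw [antitone_antiExtend_iff, ← spacedPos_stairs_add_iff (two_dvd_walkPos_sub E ht)]
      exact mem_walksIn.1 hE t ht
    · rw [ppKappa_ppTau_belowPath hx.1]
      exact belowPath_congr fun t _ => funext fun k => antiExtend_rev _ t k
  · have h1 := hclosed (mem_filter.1 (mem_coe.1 hE)).2
    have h2 := hclosed (mem_filter.1 (mem_coe.1 hF)).2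
    exact walkPos_injective fun t ht =>
      hinj (belowPath_injective h1.antiExtend h2.antiExtend h ht)
  · obtain ⟨-, hPP, hTC⟩ := mem_filter.1 hT
    obtain ⟨x, hx, hanti, rfl⟩ := exists_eq_belowPath hPP
    rw [ppKappa_ppTau_belowPath hx.1] at hTC
    have hneg {t : ℕ} (ht : t ≤ 2 * a) : (fun k => -x t k.rev) = x t :=
      belowPath_injective hx.neg_rev hx hTC ht
    obtain ⟨E, hE⟩ := IsStepPath.exists_walkPos_eq (r := 2 * a)
      (x := fun t (k : Fin m) => x t ⟨k, by omega⟩)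
      ⟨funext fun k => congrFun hx.1.1 _, fun t ht k => hx.1.2 t ht _⟩
    have hext {t : ℕ} (ht : t ≤ 2 * a) : antiExtend (walkPos E) t = x t := by
      ext k
      simp only [antiExtend, hE t ht, Fin.eta]
      split_ifs
      · rfl
      · exact congrFun (hneg ht) k
    refine ⟨E, mem_coe.2 (mem_filter.2 ⟨mem_walksIn.2 fun t ht => ?_, ?_⟩),
      belowPath_congr fun t ht => hext ht⟩
    · rw [spacedPos_stairs_add_iff (two_dvd_walkPos_sub E ht), ← antitone_antiExtend_iff, hext ht]
      exact hanti t
    · rw [hE _ le_rfl, add_eq_left]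
      exact funext fun k => congrFun hx.2 _

theorem not_transposeComplement_of_odd {a m : ℕ} (ha : a ≠ 0)
    {T : Finset (Fin a × Fin a × Fin (2 * m + 1))} (hT : IsPP a a (2 * m + 1) T) :
    ppKappa a a (2 * m + 1) (ppTau a (2 * m + 1) T) ≠ T := by
  obtain ⟨x, hx, -, rfl⟩ := exists_eq_belowPath hT
  rw [ppKappa_ppTau_belowPath hx.1]
  intro h
  let k : Fin (2 * m + 1) := ⟨m, by omega⟩
  have hk : k.rev = k := Fin.ext (by simp only [k, Fin.val_rev]; omega)
  have h1 : -x 1 k.rev = x 1 k := congrFun (belowPath_injective hx.neg_rev hx h (by omega)) k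
  have h2 := hx.1.2 0 (by omega) k
  rw [hk] at h1
  rw [hx.1.1, zero_add, Pi.zero_apply] at h2
  omega

/-- The number of transpose-complement plane partitions in an `a × a × c` box equals
the signed count `∑_T (-1)^{|T|}` over the symmetric plane partitions in the box. -/
theorem transposeComplement_count (a c : ℕ) :
    ((Finset.univ.filter fun T : Finset (Fin a × Fin a × Fin c) =>
        IsPP a a c T ∧ ppKappa a a c (ppTau a c T) = T).card : ℤ) =
      ∑ T ∈ Finset.univ.filter fun T : Finset (Fin a × Fin a × Fin c) =>
          IsPP a a c T ∧ ppTau a c T = T, (-1 : ℤ) ^ T.card := by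
  rcases a with _ | n
  · have hT (S T : Finset (Fin 0 × Fin 0 × Fin c)) : S = T := Subsingleton.elim S T
    have h (T : Finset (Fin 0 × Fin 0 × Fin c)) : IsPP 0 0 c T := fun p => p.1.elim0
    rw [filter_true_of_mem fun T _ => ⟨h T, hT _ _⟩, filter_true_of_mem fun T _ => ⟨h T, hT _ _⟩]
    simp [hT default ∅]
  rw [sum_symmetric_eq, sum_sign_walksIn fun i h => by simp only [stairs]; push_cast; ring]
  obtain ⟨m, rfl | rfl⟩ := Nat.even_or_odd' c
  · rw [card_transposeComplement_even, sum_isPaired_eq_walkCount]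
    rfl
  · rw [filter_false_of_mem fun T _ h =>
      not_transposeComplement_of_odd (Nat.succ_ne_zero n) h.1 h.2]
    refine (sum_eq_zero fun E _ => if_neg fun h => ?_).symm
    have := (h m (by omega)).1
    omega
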